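/- Let d ≥ 1 and let P be a Borel probability measure on [0,1]^d having a Lebesgue density bounded above and below by positive constants, and let g : [0,1]^d → [0,1] be measurable. There exist a constant C > 0 and an integer N, both depending only on d, such that for every n ≥ N and every real L ≥ 1 the following holds: if X_1,…,X_n are i.i.d. with law P and ℙ_n denotes the empirical measure ℙ_n h = n^{−1} Σ_{i=1}^n h(X_i), then with probability at least 1 − n^{−2}, for every pair h₁, h₂ ∈ [0,1]^d with h₁ ≤ h₂ coordinatewise and P(g·1_{[h₁,h₂]}) ≥ L·log n / n, one has | ℙ_n(g·1_{[h₁,h₂]}) / P(g·1_{[h₁,h₂]}) − 1 | ≤ C·L^{−1/2}, where [h₁,h₂] = ∏_{k=1}^d [(h₁)_k, (h₂)_k]. -/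

import Mathlib

open MeasureTheory

open scoped Classical



lemma grid_exists (ν : Measure ℝ) [IsProbabilityMeasure ν] [NullSingletonClass ν]
    (hν : ν (Set.Icc 0 1)ᶜ = 0) (n : ℕ) (hn : 1 ≤ n) :
    ∃ T : Fin (n+1) → ℝ, ∀ t ∈ Set.Icc (0:ℝ) 1, ∃ i j, T i ≤ t ∧ t ≤ T j ∧
      ν (Set.Icc (T i) (T j)) ≤ ENNReal.ofReal (2 / n) := by
  have hn0 : (0:ℝ) < n := by exact_mod_cast hn
  set F := ProbabilityTheory.cdf ν with hF
  have hmono : Monotone F := ProbabilityTheory.monotone_cdf ν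
  have hmeas : F.measure = ν := ProbabilityTheory.measure_cdf ν
  have hcont : Continuous F := by
    rw [continuous_iff_continuousAt]
    intro x
    rw [hmono.continuousAt_iff_leftLim_eq_rightLim, F.rightLim_eq]
    apply le_antisymm (hmono.leftLim_le le_rfl)
    have h := F.measure_singleton x
    rw [hmeas, measure_singleton] at h
    have := ENNReal.ofReal_eq_zero.1 h.symm
    linarith
  have hF0 : F 0 = 0 := by
    rw [hF, ProbabilityTheory.cdf_eq_real, measureReal_def]
    have : ν (Set.Iic 0) = 0 := by
      refine measure_mono_null (t := (Set.Icc 0 1)ᶜ ∪ {0}) ?_ (measure_union_null hν (measure_singleton _))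
      intro x hx
      simp only [Set.mem_Iic] at hx
      rcases hx.lt_or_eq with h | h
      · left; simp [h]
      · right; simp [h]
    simp [this]
  have hF1 : F 1 = 1 := by
    rw [hF, ProbabilityTheory.cdf_eq_real]
    have : ν (Set.Iic 1)ᶜ = 0 := by
      refine measure_mono_null ?_ hν
      intro x hx
      simp only [Set.mem_compl_iff, Set.mem_Iic, Set.mem_Icc] at hx ⊢
      tauto
    have h2 := prob_compl_eq_zero_iff (μ := ν) (measurableSet_Iic (a := (1:ℝ)))
    simp [measureReal_def, h2.1 this]
  have hs : ∀ j : Fin (n+1), ∃ t ∈ Set.Icc (0:ℝ) 1, F t = (j:ℕ) / n := by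
    intro j
    have := intermediate_value_Icc (zero_le_one (α := ℝ)) hcont.continuousOn
    have hj : ((j:ℕ):ℝ) / n ∈ Set.Icc (F 0) (F 1) := by
      rw [hF0, hF1]
      refine ⟨by positivity, ?_⟩
      rw [div_le_one hn0]
      exact_mod_cast Nat.lt_succ_iff.1 j.2
    exact this hj
  choose s hs1 hs2 using hs
  let T : Fin (n+1) → ℝ := fun j => if (j:ℕ) = 0 then 0 else if (j:ℕ) = n then 1 else s j
  have hT : ∀ j, F (T j) = (j:ℕ) / n := by
    intro j
    simp only [T]
    split_ifs with h1 h2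
    · simp [h1, hF0]
    · rw [h2, hF1]; field_simp
    · exact hs2 j
  refine ⟨T, fun t ht => ?_⟩
  have hFt0 : 0 ≤ F t := ProbabilityTheory.cdf_nonneg ν t
  have hFt1 : F t ≤ 1 := ProbabilityTheory.cdf_le_one ν t
  set m := ⌊n * F t⌋₊ with hm
  have hm1 : (m:ℝ) ≤ n * F t := Nat.floor_le (by positivity)
  have hm2 : n * F t < m + 1 := Nat.lt_floor_add_one _
  have hmn : m ≤ n := by
    have : (m:ℝ) ≤ n := by nlinarith
    exact_mod_cast this
  refine ⟨⟨m - 1, by omega⟩, ⟨min (m+1) n, by omega⟩, ?_, ?_, ?_⟩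
  · by_cases h : m - 1 = 0
    · simp only [T, h, if_true]; exact ht.1
    · by_contra hc
      have h1 := hmono (not_le.1 hc).le
      rw [hT, le_div_iff₀ hn0] at h1
      simp only at h1
      rw [Nat.cast_sub (by omega)] at h1
      push_cast at h1
      linarith
  · by_cases h : n ≤ m + 1
    · have : min (m+1) n = n := min_eq_right h
      simp only [T, this]
      rw [if_neg (by omega)]; simpa using ht.2
    · have h3 : min (m+1) n = m + 1 := min_eq_left (by omega)
      by_contra hc
      have h1 := hmono (not_le.1 hc).le
      rw [hT, div_le_iff₀ hn0] at h1
      simp only [h3] at h1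
      push_cast at h1
      linarith
  · have hIoc : ∀ a b, ν (Set.Ioc a b) = ENNReal.ofReal (F b - F a) := by
      intro a b
      rw [← F.measure_Ioc, hmeas]
    rw [← measure_congr (Ioc_ae_eq_Icc (μ := ν)), hIoc, hT, hT]
    apply ENNReal.ofReal_le_ofReal
    rw [← sub_div]
    apply div_le_div_of_nonneg_right _ hn0.le
    have : ((min (m+1) n : ℕ):ℝ) ≤ ((m - 1 : ℕ):ℝ) + 2 := by
      norm_cast; omega
    simp only
    linarith

lemma exp_bound (l y : ℝ) (hl : |l| ≤ 1) (hy : y ∈ Set.Icc (0:ℝ) 1) :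
    Real.exp (l * y) ≤ 1 + y * (l + l^2) := by
  have h1 := convexOn_exp.2 (Set.mem_univ 0) (Set.mem_univ l) (sub_nonneg.2 hy.2) hy.1 (by ring)
  simp only [smul_eq_mul, mul_zero, zero_add, Real.exp_zero, mul_one] at h1
  have h2 := (abs_le.1 (Real.abs_exp_sub_one_sub_id_le hl)).2
  rw [mul_comm l y]
  nlinarith [hy.1]

lemma chernoff {E : Type*} [MeasurableSpace E] (Pd : Measure E) [IsProbabilityMeasure Pd]
    (f : E → ℝ) (hf : Measurable f) (hf1 : ∀ x, f x ∈ Set.Icc (0:ℝ) 1) (n : ℕ)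
    {Ω : Type} [MeasurableSpace Ω] (P : Measure Ω) [IsProbabilityMeasure P]
    (X : Fin n → Ω → E) (hX : ∀ i, Measurable (X i))
    (hmap : Measure.map (fun ω => fun i : Fin n => X i ω) P = Measure.pi (fun _ : Fin n => Pd))
    (l κ : ℝ) (hl : |l| ≤ 1) :
    P {ω | n * (∫ x, f x ∂Pd) * (l + l^2) + κ ≤ l * ∑ i, f (X i ω)} ≤ ENNReal.ofReal (Real.exp (-κ)) := by
  set p := ∫ x, f x ∂Pd
  have hfi : Integrable f Pd := by
    refine Integrable.of_bound hf.aestronglyMeasurable 1 (Filter.Eventually.of_forall fun x => ?_)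
    rw [Real.norm_eq_abs, abs_le]; constructor <;> linarith [(hf1 x).1, (hf1 x).2]
  have hint : Integrable (fun ω => Real.exp (1 * (l * ∑ i, f (X i ω)))) P := by
    refine Integrable.of_bound (Measurable.aestronglyMeasurable (by fun_prop)) (Real.exp n) (Filter.Eventually.of_forall fun x => ?_)
    rw [Real.norm_eq_abs, Real.abs_exp, Real.exp_le_exp, one_mul]
    refine (le_abs_self _).trans ?_
    rw [abs_mul]
    have h0 : 0 ≤ ∑ i, f (X i x) := Finset.sum_nonneg fun i _ => (hf1 _).1
    have h1 : ∑ i, f (X i x) ≤ ∑ i : Fin n, (1:ℝ) := Finset.sum_le_sum fun i _ => (hf1 _).2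
    simp at h1
    rw [abs_of_nonneg h0]
    nlinarith [abs_nonneg l]
  have h := ProbabilityTheory.measure_ge_le_exp_mul_mgf (n * p * (l + l^2) + κ) zero_le_one hint
  have hone : ∫ x, Real.exp (l * f x) ∂Pd ≤ Real.exp (p * (l + l^2)) := by
    calc ∫ x, Real.exp (l * f x) ∂Pd ≤ ∫ x, (1 + f x * (l + l^2)) ∂Pd := by
          apply integral_mono_of_nonneg (Filter.Eventually.of_forall fun x => (Real.exp_pos _).le)
          · exact (integrable_const _).add (hfi.mul_const _)
          · exact Filter.Eventually.of_forall fun x => exp_bound l (f x) hl (hf1 x)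
      _ = 1 + p * (l + l^2) := by
          rw [integral_add (integrable_const _) (hfi.mul_const _), integral_mul_const]; simp [p]
      _ ≤ _ := by linarith [Real.add_one_le_exp (p * (l + l^2))]
  have hmgf : ProbabilityTheory.mgf (fun ω => l * ∑ i, f (X i ω)) P 1 ≤ Real.exp (n * p * (l + l^2)) := by
    have e1 : ProbabilityTheory.mgf (fun ω => l * ∑ i, f (X i ω)) P 1 =
        ∫ y, ∏ i : Fin n, Real.exp (l * f (y i)) ∂(Measure.pi (fun _ : Fin n => Pd)) := by
      rw [← hmap, integral_map (by fun_prop) (Measurable.aestronglyMeasurable (by fun_prop))]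
      simp only [ProbabilityTheory.mgf, one_mul, Finset.mul_sum, Real.exp_sum]
    rw [e1, integral_fintype_prod_eq_prod (fun (_ : Fin n) x => Real.exp (l * f x))]
    simp only [Finset.prod_const, Finset.card_univ, Fintype.card_fin]
    calc _ ≤ (Real.exp (p * (l + l^2)))^n :=
          pow_le_pow_left₀ (integral_nonneg fun x => (Real.exp_pos _).le) hone n
      _ = _ := by rw [← Real.exp_nat_mul, mul_assoc]
  rw [← ofReal_measureReal]
  apply ENNReal.ofReal_le_ofReal
  refine h.trans ?_
  calc _ ≤ Real.exp (-1 * (n * p * (l + l^2) + κ)) * Real.exp (n * p * (l + l^2)) := by gcongr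
    _ = _ := by rw [← Real.exp_add]; ring_nf

lemma q_le {E : Type*} [MeasurableSpace E] (Pd : Measure E) [IsProbabilityMeasure Pd]
    (g : E → ℝ) (hg : Measurable g) (hg1 : ∀ x, g x ∈ Set.Icc (0:ℝ) 1) (A B U : Set E)
    (hA : MeasurableSet A) (hB : MeasurableSet B) (hU : MeasurableSet U) (h : A ⊆ B ∪ U)
    (c : ℝ) (hc : 0 ≤ c) (hUc : Pd U ≤ ENNReal.ofReal c) :
    ∫ x, A.indicator g x ∂Pd ≤ ∫ x, B.indicator g x ∂Pd + c := by
  have hfi : Integrable g Pd := by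
    refine Integrable.of_bound hg.aestronglyMeasurable 1 (Filter.Eventually.of_forall fun x => ?_)
    rw [Real.norm_eq_abs, abs_le]; constructor <;> linarith [(hg1 x).1, (hg1 x).2]
  have hUi : Integrable (U.indicator (fun _ => (1:ℝ))) Pd := (integrable_const 1).indicator hU
  have hUr : ∫ x, U.indicator (fun _ => (1:ℝ)) x ∂Pd ≤ c := by
    rw [integral_indicator_const _ hU]
    simp only [smul_eq_mul, mul_one]
    exact ENNReal.toReal_le_of_le_ofReal hc hUc
  have : ∫ x, A.indicator g x ∂Pd ≤ ∫ x, (B.indicator g x + U.indicator (fun _ => (1:ℝ)) x) ∂Pd := by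
    apply integral_mono (hfi.indicator hA) ((hfi.indicator hB).add hUi)
    intro x
    have h1 := hg1 x
    have h2 : x ∈ A → x ∈ B ∨ x ∈ U := fun hx => h hx
    have h3 := h1.1
    have h4 := h1.2
    change A.indicator g x ≤ B.indicator g x + U.indicator (fun _ => (1:ℝ)) x
    by_cases ha : x ∈ A <;> by_cases hb : x ∈ B <;> by_cases hu : x ∈ U <;>
      simp only [Set.indicator_apply, ha, hb, hu, if_true, if_false] <;>
      first | linarith | (exfalso; tauto)
  rw [integral_add (hfi.indicator hB) hUi] at this
  linarith

lemma det_part (n d K l p po pin S So Sin ell : ℝ) (hn : 0 < n) (hd : 0 ≤ d) (hK : 0 ≤ K)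
    (hl : 0 < l) (hl1 : l ≤ 1) (hell : 1 ≤ ell) (hp : ell ≤ l^2 * (n * p))
    (hSo : l * So ≤ n * po * (l + l^2) + K * ell)
    (hSin : -l * Sin ≤ n * pin * (-l + (-l)^2) + K * ell)
    (h1 : Sin ≤ S) (h2 : S ≤ So) (h3 : po ≤ p + 4 * d / n) (h4 : p ≤ pin + 4 * d / n) :
    |n⁻¹ * S / p - 1| ≤ (1 + 8 * d + K) * l := by
  have hm : 0 < n * p := by
    by_contra hc
    have := mul_nonneg (sq_nonneg l) (neg_nonneg.2 (not_lt.1 hc))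
    linarith
  have hp0 : 0 < p := (mul_pos_iff_of_pos_left hn).1 hm
  have e : n⁻¹ * S / p - 1 = (S - n * p) / (n * p) := by field_simp
  set m := n * p with hmdef
  have h3' : n * po ≤ m + 4 * d := by
    have := mul_le_mul_of_nonneg_left h3 hn.le
    rw [mul_add, mul_div_cancel₀ _ hn.ne'] at this
    exact this
  have h4' : m - 4 * d ≤ n * pin := by
    have := mul_le_mul_of_nonneg_left h4 hn.le
    rw [mul_add, mul_div_cancel₀ _ hn.ne'] at this
    linarith
  have hd1 : 4 * d ≤ 4 * d * (l^2 * m) := by nlinarith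
  have hk1 : K * ell ≤ K * (l^2 * m) := mul_le_mul_of_nonneg_left hp hK
  have hl2 : l^2 ≤ l := by nlinarith
  have hdm : 0 ≤ d * m := mul_nonneg hd hm.le
  have up : So ≤ (m + 4 * d * (l^2 * m)) * (1 + l) + K * (l * m) := by
    have : l * So ≤ l * ((m + 4 * d * (l^2 * m)) * (1 + l) + K * (l * m)) := by
      have : n * po * (l + l^2) ≤ (m + 4 * d * (l^2 * m)) * (l + l^2) :=
        mul_le_mul_of_nonneg_right (by linarith) (by positivity)
      nlinarith
    exact le_of_mul_le_mul_left this hl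
  have lo : (m - 4 * d * (l^2 * m)) * (1 - l) - K * (l * m) ≤ Sin := by
    have : l * ((m - 4 * d * (l^2 * m)) * (1 - l) - K * (l * m)) ≤ l * Sin := by
      have : (m - 4 * d * (l^2 * m)) * (l - l^2) ≤ n * pin * (l - l^2) :=
        mul_le_mul_of_nonneg_right (by linarith) (by linarith)
      nlinarith
    exact le_of_mul_le_mul_left this hl
  have e1 : d * m * (l^2) ≤ d * m * l := mul_le_mul_of_nonneg_left hl2 hdm
  have e2 : d * m * (l^2 * l) ≤ d * m * l := mul_le_mul_of_nonneg_left (by nlinarith) hdm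
  have e3 : 0 ≤ d * m * (l^2 * l) := by positivity
  have e4 : 0 ≤ d * m * l := by positivity
  rw [e, abs_div, abs_of_pos hm, div_le_iff₀ hm, abs_le]
  constructor <;> nlinarith

lemma count_bound (n d : ℕ) (hn : 3 ≤ n) :
    (((n+1)^d * (n+1)^d : ℕ) : ENNReal) *
      (ENNReal.ofReal (Real.exp (-((4 * d + 3 : ℝ) * Real.log n))) +
       ENNReal.ofReal (Real.exp (-((4 * d + 3 : ℝ) * Real.log n)))) ≤ ((n:ENNReal)^2)⁻¹ := by
  have hn0 : (0:ℝ) < n := by exact_mod_cast (by omega : 0 < n)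
  have h1 : Real.exp (-((4 * d + 3 : ℝ) * Real.log n)) = ((n:ℝ)^(4*d+3))⁻¹ := by
    rw [Real.exp_neg, mul_comm, Real.exp_mul, Real.exp_log hn0]
    congr 1
    rw [← Real.rpow_natCast]; push_cast; rfl
  have e : ((n:ENNReal)^2)⁻¹ = ENNReal.ofReal (((n:ℝ)^2)⁻¹) := by
    rw [ENNReal.ofReal_inv_of_pos (by positivity), ENNReal.ofReal_pow hn0.le, ENNReal.ofReal_natCast]
  rw [h1, e, ← ENNReal.ofReal_add (by positivity) (by positivity), ← ENNReal.ofReal_natCast,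
    ← ENNReal.ofReal_mul (by positivity)]
  apply ENNReal.ofReal_le_ofReal
  have h2 : ((n:ℝ)+1)^d ≤ (n:ℝ)^(2*d) := by
    rw [pow_mul]
    apply pow_le_pow_left₀ (by positivity)
    have : (3:ℝ) ≤ n := by exact_mod_cast hn
    nlinarith
  push_cast
  have h3 : ((n:ℝ)+1)^d * ((n:ℝ)+1)^d ≤ (n:ℝ)^(4*d) := by
    calc _ ≤ (n:ℝ)^(2*d) * (n:ℝ)^(2*d) := by gcongr
      _ = _ := by rw [← pow_add]; congr 1; ring
  calc _ ≤ (n:ℝ)^(4*d) * (((n:ℝ)^(4*d+3))⁻¹ + ((n:ℝ)^(4*d+3))⁻¹) := by gcongr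
    _ = 2 / n * ((n:ℝ)^2)⁻¹ := by rw [pow_add]; field_simp; norm_num
    _ ≤ 1 * ((n:ℝ)^2)⁻¹ := by
      gcongr
      rw [div_le_one hn0]
      exact_mod_cast (by omega : 2 ≤ n)
    _ = _ := one_mul _

/-- Lemma 7 of the paper: a uniform-over-rectangles ratio concentration inequality for
the empirical measure of i.i.d. samples from a distribution on `[0,1]^d` with a Lebesgue
density bounded above and below by positive constants. -/
theorem stmt16 (d : ℕ) (hd : 1 ≤ d) :
    ∃ C : ℝ, 0 < C ∧ ∃ N : ℕ,
      ∀ (Pd : Measure (Fin d → ℝ)), IsProbabilityMeasure Pd →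
      ∀ (π : (Fin d → ℝ) → ℝ),
        Pd = MeasureTheory.volume.withDensity (fun x => ENNReal.ofReal (π x)) →
        (∀ x, x ∉ Set.Icc (0 : Fin d → ℝ) 1 → π x = 0) →
        (∃ c₁ c₂ : ℝ, 0 < c₁ ∧ 0 < c₂ ∧
          ∀ x ∈ Set.Icc (0 : Fin d → ℝ) 1, c₁ ≤ π x ∧ π x ≤ c₂) →
      ∀ (g : (Fin d → ℝ) → ℝ), Measurable g → (∀ x, g x ∈ Set.Icc (0 : ℝ) 1) →
      ∀ n : ℕ, N ≤ n → ∀ L : ℝ, 1 ≤ L →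
      ∀ (Ω : Type) (_ : MeasurableSpace Ω) (P : Measure Ω), IsProbabilityMeasure P →
      ∀ (X : Fin n → Ω → (Fin d → ℝ)), (∀ i, Measurable (X i)) →
        Measure.map (fun ω => fun i : Fin n => X i ω) P =
          Measure.pi (fun _ : Fin n => Pd) →
        1 - (((n : ENNReal)) ^ 2)⁻¹ ≤
          P {ω : Ω |
            ∀ h₁ h₂ : Fin d → ℝ, h₁ ∈ Set.Icc (0 : Fin d → ℝ) 1 →
              h₂ ∈ Set.Icc (0 : Fin d → ℝ) 1 → h₁ ≤ h₂ →
              L * Real.log n / n ≤ ∫ x in Set.Icc h₁ h₂, g x ∂Pd →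
              |((n : ℝ)⁻¹ * ∑ i : Fin n,
                    if X i ω ∈ Set.Icc h₁ h₂ then g (X i ω) else 0) /
                  (∫ x in Set.Icc h₁ h₂, g x ∂Pd) - 1| ≤
                C * L ^ (-(1 / 2 : ℝ))} := by
  refine ⟨1 + 8 * d + (4 * d + 3), by positivity, 3, ?_⟩
  intro Pd hPd π hπ hπ0 _ g hg hg1 n hn L hL Ω _ P hP X hX hmap
  have hn0 : (0:ℝ) < n := by exact_mod_cast (by omega : 0 < n)
  have hlog : 1 ≤ Real.log n := by
    rw [Real.le_log_iff_exp_le hn0]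
    have : (3:ℝ) ≤ n := by exact_mod_cast hn
    linarith [Real.exp_one_lt_d9]
  have hL0 : 0 < L := by linarith
  set l := L ^ (-(1 / 2 : ℝ)) with hl
  have hlpos : 0 < l := Real.rpow_pos_of_pos hL0 _
  have hl1 : l ≤ 1 := Real.rpow_le_one_of_one_le_of_nonpos hL (by norm_num)
  have hl2 : l ^ 2 * L = 1 := by
    rw [hl, ← Real.rpow_natCast, ← Real.rpow_mul hL0.le]
    norm_num
    rw [Real.rpow_neg_one]
    field_simp
  have hac : Pd ≪ volume := hπ ▸ withDensity_absolutelyContinuous _ _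
  have hcube : Pd (Set.Icc 0 1)ᶜ = 0 := by
    rw [hπ, withDensity_apply _ measurableSet_Icc.compl]
    rw [setLIntegral_congr_fun (g := fun _ => 0) measurableSet_Icc.compl]
    · simp
    · intro x hx
      simp [hπ0 x hx]
  have hgrid : ∀ k : Fin d, ∃ T : Fin (n+1) → ℝ, ∀ t ∈ Set.Icc (0:ℝ) 1, ∃ i j, T i ≤ t ∧ t ≤ T j ∧
      Pd {x | x k ∈ Set.Icc (T i) (T j)} ≤ ENNReal.ofReal (2 / n) := by
    intro k
    have hmk : Measurable (fun x : Fin d → ℝ => x k) := measurable_pi_apply k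
    haveI : IsProbabilityMeasure (Pd.map (fun x : Fin d → ℝ => x k)) :=
      Measure.isProbabilityMeasure_map hmk.aemeasurable
    haveI : NullSingletonClass (Pd.map (fun x : Fin d → ℝ => x k)) := by
      constructor
      intro a
      rw [Measure.map_apply hmk (measurableSet_singleton a)]
      apply hac
      exact (Measure.quasiMeasurePreserving_eval (fun _ : Fin d => (volume : Measure ℝ)) k).preimage_null
        (measure_singleton a)
    obtain ⟨T, hT⟩ := grid_exists (Pd.map (fun x : Fin d → ℝ => x k)) (by
      rw [Measure.map_apply hmk measurableSet_Icc.compl]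
      refine measure_mono_null ?_ hcube
      intro x hx hx2
      exact hx ⟨hx2.1 k, hx2.2 k⟩) n (by omega)
    refine ⟨T, fun t ht => ?_⟩
    obtain ⟨i, j, h1, h2, h3⟩ := hT t ht
    refine ⟨i, j, h1, h2, ?_⟩
    rwa [Measure.map_apply hmk measurableSet_Icc] at h3
  choose T hT using hgrid
  let box : (Fin d → Fin (n+1)) × (Fin d → Fin (n+1)) → Set (Fin d → ℝ) :=
    fun a => Set.Icc (fun k => T k (a.1 k)) (fun k => T k (a.2 k))
  let q : Set (Fin d → ℝ) → ℝ := fun A => ∫ x, A.indicator g x ∂Pd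
  let S : Set (Fin d → ℝ) → Ω → ℝ := fun A ω => ∑ i, A.indicator g (X i ω)
  let bad : ℝ → (Fin d → Fin (n+1)) × (Fin d → Fin (n+1)) → Set Ω := fun r a =>
    {ω | n * q (box a) * (r + r^2) + (4 * d + 3) * Real.log n ≤ r * S (box a) ω}
  have hbad : ∀ r a, |r| ≤ 1 →
      P (bad r a) ≤ ENNReal.ofReal (Real.exp (-((4 * d + 3 : ℝ) * Real.log n))) := by
    intro r a hr
    refine chernoff Pd ((box a).indicator g) (hg.indicator measurableSet_Icc) ?_ n P X hX hmap r _ hr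
    intro x
    by_cases h : x ∈ box a
    · simpa [h] using hg1 x
    · simp [h]
  have habs : |l| ≤ 1 := by rw [abs_of_pos hlpos]; exact hl1
  have hall : P (⋃ a, (bad l a ∪ bad (-l) a)) ≤ ((n:ENNReal)^2)⁻¹ := by
    refine le_trans ?_ (count_bound n d hn)
    refine (measure_iUnion_fintype_le _ _).trans ?_
    refine (Finset.sum_le_sum (fun a _ => (measure_union_le _ _).trans
      (add_le_add (hbad l a habs) (hbad (-l) a (by rwa [abs_neg]))))).trans ?_
    rw [Finset.sum_const, Finset.card_univ, nsmul_eq_mul]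
    simp
  rw [tsub_le_iff_right]
  refine le_trans ?_ (add_le_add_right hall _)
  rw [← measure_univ (μ := P)]
  refine le_trans (measure_mono ?_) (measure_union_le _ _)
  intro ω _
  by_cases hω : ω ∈ ⋃ a, (bad l a ∪ bad (-l) a)
  · exact Or.inr hω
  left
  simp only [Set.mem_iUnion, Set.mem_union, not_exists, not_or] at hω
  intro h₁ h₂ hh₁ hh₂ h12 hp
  have hq : ∫ x in Set.Icc h₁ h₂, g x ∂Pd = q (Set.Icc h₁ h₂) :=
    (integral_indicator measurableSet_Icc).symm
  have hS : (∑ i : Fin n, if X i ω ∈ Set.Icc h₁ h₂ then g (X i ω) else 0) = S (Set.Icc h₁ h₂) ω := by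
    apply Finset.sum_congr rfl
    intro i _
    by_cases h : X i ω ∈ Set.Icc h₁ h₂ <;> simp [h]
  rw [hq] at hp
  rw [hq, hS]
  choose i₁ j₁ a1 a2 a3 using fun k => hT k (h₁ k) ⟨hh₁.1 k, hh₁.2 k⟩
  choose i₂ j₂ b1 b2 b3 using fun k => hT k (h₂ k) ⟨hh₂.1 k, hh₂.2 k⟩
  let U : Set (Fin d → ℝ) := ⋃ k, ({x | x k ∈ Set.Icc (T k (i₁ k)) (T k (j₁ k))} ∪
    {x | x k ∈ Set.Icc (T k (i₂ k)) (T k (j₂ k))})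
  have hU : MeasurableSet U := by
    refine MeasurableSet.iUnion fun k => ?_
    exact ((measurable_pi_apply k) measurableSet_Icc).union ((measurable_pi_apply k) measurableSet_Icc)
  have hUc : Pd U ≤ ENNReal.ofReal (4 * d / n) := by
    refine (measure_iUnion_fintype_le _ _).trans ?_
    refine (Finset.sum_le_sum (fun k _ => (measure_union_le _ _).trans
      (add_le_add (a3 k) (b3 k)))).trans ?_
    rw [Finset.sum_const, Finset.card_univ, nsmul_eq_mul, ← ENNReal.ofReal_add (by positivity) (by positivity),
      ← ENNReal.ofReal_natCast, ← ENNReal.ofReal_mul (by positivity)]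
    apply ENNReal.ofReal_le_ofReal
    apply le_of_eq
    rw [Fintype.card_fin]
    field_simp
    norm_num
  have hin : box (j₁, i₂) ⊆ Set.Icc h₁ h₂ := fun x hx =>
    ⟨fun k => (a2 k).trans (hx.1 k), fun k => (hx.2 k).trans (b1 k)⟩
  have hout : Set.Icc h₁ h₂ ⊆ box (i₁, j₂) := fun x hx =>
    ⟨fun k => (a1 k).trans (hx.1 k), fun k => (hx.2 k).trans (b2 k)⟩
  have hmonoS : ∀ A B : Set (Fin d → ℝ), A ⊆ B → S A ω ≤ S B ω := fun A B h =>
    Finset.sum_le_sum fun i _ => Set.indicator_le_indicator_of_subset h (fun x => (hg1 x).1) _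
  have hinU : Set.Icc h₁ h₂ ⊆ box (j₁, i₂) ∪ U := by
    intro x hx
    by_cases h : x ∈ U
    · exact Or.inr h
    left
    simp only [U, Set.mem_iUnion, Set.mem_union, not_exists, not_or, Set.mem_setOf_eq, Set.mem_Icc, not_and,
      not_le] at h
    exact ⟨fun k => ((h k).1 ((a1 k).trans (hx.1 k))).le, fun k => by
      by_contra hc
      have := (h k).2 (not_le.1 hc).le
      linarith [hx.2 k, b2 k]⟩
  have houtU : box (i₁, j₂) ⊆ Set.Icc h₁ h₂ ∪ U := by
    intro x hx
    by_cases h : x ∈ U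
    · exact Or.inr h
    left
    simp only [U, Set.mem_iUnion, Set.mem_union, not_exists, not_or, Set.mem_setOf_eq, Set.mem_Icc, not_and,
      not_le] at h
    exact ⟨fun k => (a2 k).trans ((h k).1 (hx.1 k)).le, fun k => by
      by_contra hc
      have := (h k).2 ((b1 k).trans (not_le.1 hc).le)
      have h5 := hx.2 k
      simp only at h5
      linarith⟩
  refine det_part n d (4 * d + 3) l (q (Set.Icc h₁ h₂)) (q (box (i₁, j₂))) (q (box (j₁, i₂)))
    _ (S (box (i₁, j₂)) ω) (S (box (j₁, i₂)) ω) (Real.log n) hn0 (by positivity) (by positivity) hlpos hl1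
    hlog ?_ (not_le.1 (hω (i₁, j₂)).1).le (not_le.1 (hω (j₁, i₂)).2).le
    (hmonoS _ _ hin) (hmonoS _ _ hout) ?_ ?_
  · rw [div_le_iff₀ hn0] at hp
    calc Real.log n = l^2 * (L * Real.log n) := by rw [← mul_assoc, hl2, one_mul]
      _ ≤ l^2 * (q (Set.Icc h₁ h₂) * n) := by gcongr
      _ = _ := by ring
  · exact q_le Pd g hg hg1 _ _ U measurableSet_Icc measurableSet_Icc hU houtU _ (by positivity) hUc
  · exact q_le Pd g hg hg1 _ _ U measurableSet_Icc measurableSet_Icc hU hinU _ (by positivity) hUc
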